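/- arXiv:1404.1112 — 2 statements merged into one kernel-verified Lean document; each statement's English description precedes it below -/
import Mathlib

section
/- Fix a nonincreasing vector d ∈ ℕ^T and a supply profile p ∈ ℕ^T. Define supplemental purchases sequentially by: a_1 = (d_T − p_1)^+, and for t ≥ 2, a_t is the smallest nonnegative integer such that (p_1+a_1, p_2+a_2, …, p_t+a_t) weakly majorizes (d_{T−t+1}, d_{T−t+2}, …, d_T) (i.e., for every nonempty subset S ⊆ {1,…,t} with |S| = k, ∑_{r∈S}(p_r+a_r) ≥ ∑_{s=T−k+1}^T d_s). Then: (i) each a_t is well defined; (ii) the resulting total supply satisfies d ⪯^w (p + a); and (iii) ∑_{t=1}^T a_t = max_{1≤t≤T} ( ∑_{s=t}^T (d_s − p↓_s) )^+, so this sequential strategy—which at time t uses only p_1,…,p_t—purchases the minimum total amount over all a ∈ ℕ^T with d ⪯^w (p + a). -/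
open Finset

/-- The nonincreasing rearrangement `a↓` of `a`. -/
def sortedDesc {T : ℕ} (a : Fin T → ℕ) : Fin T → ℕ := fun t => a (Tuple.sort a t.rev)

/-- Sum of the last `k` entries of `d` (i.e. `∑_{s = T-k+1}^{T} d_s`, 1-indexed). -/
def lastSum {T : ℕ} (d : Fin T → ℕ) (k : ℕ) : ℕ :=
  ∑ s ∈ univ.filter (fun s : Fin T => T - k ≤ (s : ℕ)), d s

/-- The sequential purchase strategy: `seqA d p t` is the smallest `m ∈ ℕ` such that
for every nonempty subset `S ⊆ {1,…,t}`, `∑_{r ∈ S} (p_r + a_r) ≥ ∑_{s=T-|S|+1}^T d_s`,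
where `a_r` is the already-defined purchase for `r < t` and `a_t = m`. -/
noncomputable def seqA {T : ℕ} (d p : Fin T → ℕ) : Fin T → ℕ
  | t =>
    sInf {m : ℕ |
      ∀ S : Finset (Fin T), S.Nonempty → (∀ r ∈ S, r ≤ t) →
        lastSum d S.card ≤ ∑ r ∈ S, (p r + if hr : r < t then seqA d p r else m)}
  termination_by t => (t : ℕ)
  decreasing_by exact hr

section Sorting

variable {T : ℕ}

/-- The last positions of the nonincreasing rearrangement of `v` sum to the total of `v` over a
set on which `v` is smallest. -/
theorem exists_sum_eq_sum_sortedDesc (v : Fin T → ℕ) (t : Fin T) :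
    ∃ M : Finset (Fin T), M.card = T - t ∧ ∑ s ∈ Ici t, sortedDesc v s = ∑ r ∈ M, v r ∧
      ∀ S : Finset (Fin T), S.card = T - t → ∑ r ∈ M, v r ≤ ∑ r ∈ S, v r := by
  set e : Equiv.Perm (Fin T) := Fin.revPerm.trans (Tuple.sort v)
  have hanti : Antitone fun s => v (e s) := fun a b hab =>
    Tuple.monotone_sort v (Fin.rev_le_rev.2 hab)
  have hcard : ((Ici t).map e.toEmbedding).card = T - t := by simp
  refine ⟨(Ici t).map e.toEmbedding, hcard, ?_, fun S hS => ?_⟩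
  · rw [sum_map]; rfl
  · set M := (Ici t).map e.toEmbedding
    have hM_le : ∀ r ∈ M \ S, v r ≤ v (e t) := by
      intro r hr
      obtain ⟨s, hs, rfl⟩ := mem_map.1 (mem_sdiff.1 hr).1
      exact hanti (mem_Ici.1 hs)
    have hle_S : ∀ r ∈ S \ M, v (e t) ≤ v r := by
      intro r hr
      have hr' := (mem_sdiff.1 hr).2
      obtain ⟨s, rfl⟩ := e.surjective r
      refine hanti (le_of_not_ge fun hts => hr' (mem_map.2 ⟨s, mem_Ici.2 hts, rfl⟩))
    have hc : (M \ S).card = (S \ M).card := card_sdiff_comm (hcard.trans hS.symm)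
    have h1 := sum_le_card_nsmul _ _ _ hM_le
    have h2 := card_nsmul_le_sum _ _ _ hle_S
    rw [hc] at h1
    rw [← sum_inter_add_sum_sdiff M S, ← sum_inter_add_sum_sdiff S M, inter_comm S M]
    exact Nat.add_le_add_left (h1.trans h2) _

theorem sum_sortedDesc_le_sum (v : Fin T → ℕ) (t : Fin T) (S : Finset (Fin T))
    (hS : S.card = T - t) : ∑ s ∈ Ici t, sortedDesc v s ≤ ∑ r ∈ S, v r := by
  obtain ⟨M, -, hM, hmin⟩ := exists_sum_eq_sum_sortedDesc v t
  exact hM.trans_le (hmin S hS)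

end Sorting

section LastSum

variable {T : ℕ}

theorem lastSum_zero (d : Fin T → ℕ) : lastSum d 0 = 0 := by
  refine sum_eq_zero fun s hs => ?_
  have := (mem_filter.1 hs).2
  omega

theorem lastSum_eq_sum_Ici (d : Fin T → ℕ) (t : Fin T) :
    lastSum d (T - t) = ∑ s ∈ Ici t, d s := by
  refine sum_congr ?_ fun _ _ => rfl
  ext s
  simp only [mem_filter, mem_univ, true_and, mem_Ici, Fin.le_def]
  omega

theorem lastSum_succ (d : Fin T → ℕ) {k : ℕ} (hk : k < T) :
    lastSum d (k + 1) = lastSum d k + d ⟨T - 1 - k, by omega⟩ := by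
  have hset : univ.filter (fun s : Fin T => T - (k + 1) ≤ (s : ℕ)) =
      insert ⟨T - 1 - k, by omega⟩ (univ.filter fun s : Fin T => T - k ≤ (s : ℕ)) := by
    ext s
    simp only [mem_filter, mem_univ, true_and, mem_insert, Fin.ext_iff]
    omega
  rw [lastSum, hset, sum_insert (by simp; omega), add_comm]
  rfl

/-- `lastSum d` is convex when `d` is nonincreasing. -/
theorem lastSum_add_le {d : Fin T → ℕ} (hd : Antitone d) {m j : ℕ} (hmj : m ≤ j) (c : ℕ)
    (hc : j + c ≤ T) :
    lastSum d (m + c) + lastSum d j ≤ lastSum d (j + c) + lastSum d m := by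
  induction c with
  | zero => simp [add_comm]
  | succ c ih =>
    have := ih (by omega)
    rw [← add_assoc, ← add_assoc, lastSum_succ d (k := m + c) (by omega),
      lastSum_succ d (k := j + c) (by omega)]
    have : d ⟨T - 1 - (m + c), by omega⟩ ≤ d ⟨T - 1 - (j + c), by omega⟩ :=
      hd (Fin.mk_le_mk.2 (by omega))
    omega

theorem lastSum_card_add_le {d : Fin T → ℕ} (hd : Antitone d) (S S' : Finset (Fin T)) :
    lastSum d S.card + lastSum d S'.card ≤
      lastSum d (S ∪ S').card + lastSum d (S ∩ S').card := by
  have h := card_union_add_card_inter S S'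
  have h1 : (S ∩ S').card ≤ S.card := card_le_card inter_subset_left
  have h2 : (S ∩ S').card ≤ S'.card := card_le_card inter_subset_right
  have h3 : (S ∪ S').card ≤ T := by simpa using card_le_univ (S ∪ S')
  have := lastSum_add_le hd h2 (S.card - (S ∩ S').card) (by omega)
  rwa [show (S ∩ S').card + (S.card - (S ∩ S').card) = S.card by omega,
    show S'.card + (S.card - (S ∩ S').card) = (S ∪ S').card by omega] at this

theorem lastSum_le_sum (d : Fin T → ℕ) (k : ℕ) : lastSum d k ≤ ∑ s, d s :=
  sum_le_sum_of_subset (filter_subset _ _)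

end LastSum

section Sequential

variable {T : ℕ}

/-- The amounts that, bought at time `t` after the purchases of `seqA`, keep the supply up to
time `t` adequate. -/
def feasibleAt (d p : Fin T → ℕ) (t : Fin T) : Set ℕ :=
  {m : ℕ | ∀ S : Finset (Fin T), S.Nonempty → (∀ r ∈ S, r ≤ t) →
    lastSum d S.card ≤ ∑ r ∈ S, (p r + if hr : r < t then seqA d p r else m)}

theorem seqA_eq_sInf (d p : Fin T → ℕ) (t : Fin T) : seqA d p t = sInf (feasibleAt d p t) := by
  rw [seqA]; rfl

theorem sum_dite_seqA (d p : Fin T → ℕ) {t : Fin T} {S : Finset (Fin T)} (hS : ∀ r ∈ S, r ≤ t) :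
    ∑ r ∈ S, (p r + if hr : r < t then seqA d p r else seqA d p t) =
      ∑ r ∈ S, (p r + seqA d p r) := by
  refine sum_congr rfl fun r hr => ?_
  split_ifs with h
  · rfl
  · rw [le_antisymm (hS r hr) (not_lt.1 h)]

theorem feasibleAt_nonempty_of_adequate_before (d p : Fin T → ℕ) (t : Fin T)
    (h : ∀ S : Finset (Fin T), (∀ r ∈ S, r < t) →
      lastSum d S.card ≤ ∑ r ∈ S, (p r + seqA d p r)) :
    (feasibleAt d p t).Nonempty := by
  refine ⟨∑ s, d s, fun S _ hSt => ?_⟩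
  by_cases ht : t ∈ S
  · refine (lastSum_le_sum d _).trans ?_
    refine le_trans ?_ (single_le_sum (f := fun r => p r + if hr : r < t then seqA d p r
      else ∑ s, d s) (fun _ _ => Nat.zero_le _) ht)
    simp
  · have hlt : ∀ r ∈ S, r < t := fun r hr => (hSt r hr).lt_of_ne fun e => ht (e ▸ hr)
    refine (h S hlt).trans_eq (sum_congr rfl fun r hr => ?_)
    rw [dif_pos (hlt r hr)]

theorem seqA_adequate_upTo (d p : Fin T → ℕ) (t : Fin T) (S : Finset (Fin T))
    (hS : ∀ r ∈ S, r ≤ t) : lastSum d S.card ≤ ∑ r ∈ S, (p r + seqA d p r) := by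
  induction t using WellFoundedLT.induction generalizing S with
  | ind t ih =>
  rcases S.eq_empty_or_nonempty with rfl | hne
  · simp [lastSum_zero]
  have hF : (feasibleAt d p t).Nonempty := by
    refine feasibleAt_nonempty_of_adequate_before d p t fun S' hS' => ?_
    rcases S'.eq_empty_or_nonempty with rfl | hne'
    · simp [lastSum_zero]
    · exact ih _ (hS' _ (S'.max'_mem hne')) S' fun r hr => S'.le_max' r hr
  have hmem := Nat.sInf_mem hF
  rw [← seqA_eq_sInf] at hmem
  exact (hmem S hne hS).trans_eq (sum_dite_seqA d p hS)

theorem seqA_adequate (d p : Fin T → ℕ) (S : Finset (Fin T)) :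
    lastSum d S.card ≤ ∑ r ∈ S, (p r + seqA d p r) := by
  rcases S.eq_empty_or_nonempty with rfl | hne
  · simp [lastSum_zero]
  · exact seqA_adequate_upTo d p (S.max' hne) S fun r hr => S.le_max' r hr

theorem feasibleAt_nonempty (d p : Fin T → ℕ) (t : Fin T) : (feasibleAt d p t).Nonempty :=
  feasibleAt_nonempty_of_adequate_before d p t fun S _ => seqA_adequate d p S

theorem seqA_first (d p : Fin T → ℕ) {t l : Fin T} (ht : (t : ℕ) = 0)
    (hl : (l : ℕ) = T - 1) : seqA d p t = d l - p t := by
  have hone : lastSum d 1 = d l := by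
    have h := lastSum_eq_sum_Ici d l
    have hIci : Ici l = {l} := by
      ext s
      simp only [mem_Ici, mem_singleton, Fin.le_def, Fin.ext_iff]
      omega
    rwa [hIci, sum_singleton, show T - (l : ℕ) = 1 by omega] at h
  apply le_antisymm
  · rw [seqA_eq_sInf]
    refine Nat.sInf_le fun S hne hS => ?_
    obtain rfl : S = {t} := hne.subset_singleton_iff.1 fun r hr => by
      have := Fin.le_def.1 (hS r hr)
      exact mem_singleton.2 (Fin.ext (by omega))
    simp only [card_singleton, sum_singleton, lt_irrefl, dite_false, hone]
    omega
  · have := seqA_adequate d p {t}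
    simp only [card_singleton, sum_singleton, hone] at this
    omega

/-- A positive purchase is forced by a tight set. -/
theorem exists_tight_of_seqA_pos (d p : Fin T → ℕ) (t : Fin T) (ht : 0 < seqA d p t) :
    ∃ S : Finset (Fin T), t ∈ S ∧ (∀ r ∈ S, r ≤ t) ∧
      lastSum d S.card = ∑ r ∈ S, (p r + seqA d p r) := by
  have hnot : seqA d p t - 1 ∉ feasibleAt d p t := by
    apply Nat.notMem_of_lt_sInf
    rw [← seqA_eq_sInf]
    omega
  simp only [feasibleAt, Set.mem_ofPred_eq, not_forall, not_le] at hnot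
  obtain ⟨S, -, hSt, hlt⟩ := hnot
  have hle := seqA_adequate d p S
  have hrest : ∀ S' ⊆ S, t ∉ S' →
      ∑ r ∈ S', (p r + if hr : r < t then seqA d p r else seqA d p t - 1) =
        ∑ r ∈ S', (p r + seqA d p r) := fun S' hS' htS' => sum_congr rfl fun r hr => by
    rw [dif_pos ((hSt r (hS' hr)).lt_of_ne fun e => htS' (e ▸ hr))]
  by_cases htS : t ∈ S
  · refine ⟨S, htS, hSt, le_antisymm hle ?_⟩
    rw [← add_sum_erase _ _ htS, hrest _ (erase_subset _ _) (notMem_erase _ _),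
      dif_neg (lt_irrefl t)] at hlt
    rw [← add_sum_erase _ _ htS]
    omega
  · rw [hrest S Subset.rfl htS] at hlt
    omega

theorem tight_union {d p : Fin T → ℕ} (hd : Antitone d) {S S' : Finset (Fin T)}
    (hS : lastSum d S.card = ∑ r ∈ S, (p r + seqA d p r))
    (hS' : lastSum d S'.card = ∑ r ∈ S', (p r + seqA d p r)) :
    lastSum d (S ∪ S').card = ∑ r ∈ S ∪ S', (p r + seqA d p r) := by
  have h1 := lastSum_card_add_le hd S S'
  have h2 := seqA_adequate d p (S ∪ S')
  have h3 := seqA_adequate d p (S ∩ S')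
  have h4 := sum_union_inter (s₁ := S) (s₂ := S') (f := fun r => p r + seqA d p r)
  omega

/-- Some tight set contains all times of positive purchase. -/
theorem exists_tight_support {d : Fin T → ℕ} (hd : Antitone d) (p : Fin T → ℕ) :
    ∃ S : Finset (Fin T), lastSum d S.card = ∑ r ∈ S, (p r + seqA d p r) ∧
      ∀ r ∉ S, seqA d p r = 0 := by
  suffices h : ∀ A : Finset (Fin T), ∃ S : Finset (Fin T),
      lastSum d S.card = ∑ r ∈ S, (p r + seqA d p r) ∧ ∀ r ∈ A, r ∉ S → seqA d p r = 0 by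
    simpa using h univ
  intro A
  induction A using Finset.induction_on with
  | empty => exact ⟨∅, by simp [lastSum_zero]⟩
  | insert t A _ ih =>
    obtain ⟨S, hS, hzero⟩ := ih
    rcases Nat.eq_zero_or_pos (seqA d p t) with h0 | hpos
    · refine ⟨S, hS, fun r hr hrS => ?_⟩
      rcases mem_insert.1 hr with rfl | hr
      · exact h0
      · exact hzero r hr hrS
    · obtain ⟨S', htS', -, hS'⟩ := exists_tight_of_seqA_pos d p t hpos
      refine ⟨S ∪ S', tight_union hd hS hS', fun r hr hrS => ?_⟩
      rw [mem_union, not_or] at hrS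
      rcases mem_insert.1 hr with rfl | hr
      · exact absurd htS' hrS.2
      · exact hzero r hr hrS.1

/-- The total purchase is the shortfall of `p` on some set of times. -/
theorem exists_lastSum_eq_sum_add_sum_seqA {d : Fin T → ℕ} (hd : Antitone d) (p : Fin T → ℕ) :
    ∃ S : Finset (Fin T), lastSum d S.card = ∑ r ∈ S, p r + ∑ t, seqA d p t := by
  obtain ⟨S, hS, hzero⟩ := exists_tight_support hd p
  refine ⟨S, ?_⟩
  rw [hS, sum_add_distrib, sum_subset (subset_univ S) fun r _ hr => hzero r hr]

end Sequential

/-- The sequential purchase strategy is well defined, yields an adequate total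
supply, and purchases in total exactly
`max_{1 ≤ t ≤ T} (∑_{s=t}^T (d_s − p↓_s))⁺`, hence is optimal among all purchase
vectors making the supply weakly majorize `d` — even though at time `t` it only
uses `p_1, …, p_t`.  (Its first purchase is `a_1 = (d_T − p_1)⁺`.) -/
theorem seqA_optimal {T : ℕ} (hT : 0 < T) (d p : Fin T → ℕ) (hd : Antitone d) :
    -- (i) each `a_t` is well defined: the defining set is nonempty
    (∀ t : Fin T,
      {m : ℕ |
        ∀ S : Finset (Fin T), S.Nonempty → (∀ r ∈ S, r ≤ t) →
          lastSum d S.card ≤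
            ∑ r ∈ S, (p r + if hr : r < t then seqA d p r else m)}.Nonempty) ∧
    -- the first purchase is `(d_T − p_1)⁺` (truncated subtraction)
    seqA d p ⟨0, hT⟩ = d ⟨T - 1, by omega⟩ - p ⟨0, hT⟩ ∧
    -- (ii) the resulting total supply weakly majorizes `d`
    (∀ t : Fin T,
      ∑ s ∈ Ici t, d s ≤ ∑ s ∈ Ici t, sortedDesc (fun u => p u + seqA d p u) s) ∧
    -- (iii) the total purchase equals `max_t (∑_{s≥t} (d_s − p↓_s))⁺` …
    ((∑ t, seqA d p t : ℤ) =
      univ.sup' ⟨⟨0, hT⟩, mem_univ _⟩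
        (fun t : Fin T =>
          max 0 (∑ s ∈ Ici t, ((d s : ℤ) - (sortedDesc p s : ℤ))))) ∧
    -- … hence is minimal among all adequate purchase vectors
    (∀ b : Fin T → ℕ,
      (∀ t : Fin T,
        ∑ s ∈ Ici t, d s ≤ ∑ s ∈ Ici t, sortedDesc (fun u => p u + b u) s) →
      ∑ t, seqA d p t ≤ ∑ t, b t) := by
  have hsum : ∀ (b : Fin T → ℕ) (S : Finset (Fin T)), ∑ r ∈ S, b r ≤ ∑ r, b r := fun b S =>
    sum_le_sum_of_subset (subset_univ S)
  have hmaj : ∀ t : Fin T,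
      ∑ s ∈ Ici t, d s ≤ ∑ s ∈ Ici t, sortedDesc (fun u => p u + seqA d p u) s := by
    intro t
    obtain ⟨M, hM, hMsum, -⟩ := exists_sum_eq_sum_sortedDesc (fun u => p u + seqA d p u) t
    rw [hMsum, ← lastSum_eq_sum_Ici, ← hM]
    exact seqA_adequate d p M
  obtain ⟨S, hS⟩ := exists_lastSum_eq_sum_add_sum_seqA hd p
  have hindex : S.Nonempty → ∃ t : Fin T, S.card = T - t := fun hne => by
    have h1 := hne.card_pos
    have h2 : S.card ≤ T := by simpa using card_le_univ S
    exact ⟨⟨T - S.card, by omega⟩, by simp only; omega⟩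
  refine ⟨feasibleAt_nonempty d p, seqA_first d p rfl rfl, hmaj, le_antisymm ?_ ?_, fun b hb => ?_⟩
  · rcases S.eq_empty_or_nonempty with rfl | hne
    · simp only [card_empty, lastSum_zero, sum_empty, zero_add] at hS
      rw [← Nat.cast_sum, ← hS]
      exact le_sup'_of_le _ (mem_univ ⟨0, hT⟩) (le_max_left _ _)
    · obtain ⟨t, ht⟩ := hindex hne
      refine le_sup'_of_le _ (mem_univ t) (le_max_of_le_right ?_)
      have hp := sum_sortedDesc_le_sum p t S ht
      rw [ht, lastSum_eq_sum_Ici] at hS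
      rw [sum_sub_distrib]
      zify at hp hS
      linarith
  · refine sup'_le _ _ fun t _ => max_le (by positivity) ?_
    obtain ⟨M, hM, hMsum, -⟩ := exists_sum_eq_sum_sortedDesc p t
    have h1 := (hmaj t).trans (sum_sortedDesc_le_sum _ t M hM)
    have h2 := hsum (seqA d p) M
    rw [sum_add_distrib, ← hMsum] at h1
    rw [sum_sub_distrib]
    zify at h1 h2
    linarith
  · rcases S.eq_empty_or_nonempty with rfl | hne
    · simp only [card_empty, lastSum_zero, sum_empty, zero_add] at hS
      exact hS ▸ Nat.zero_le _
    · obtain ⟨t, ht⟩ := hindex hne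
      have h1 := (hb t).trans (sum_sortedDesc_le_sum _ t S ht)
      have h2 := hsum b S
      rw [sum_add_distrib] at h1
      rw [ht, lastSum_eq_sum_Ici] at hS
      omega
end

section
/- (Social welfare, convex utility.) Suppose r ∈ ℕ^T is nonincreasing (r = r↓), U : {0,1,…,T} → ℝ satisfies U(0) = 0 and has nonnegative, nondecreasing increments (U(h) − U(h−1) is nonnegative and nondecreasing in h), the number of consumers N exceeds r_1, and c ≥ 0 is the unit price of purchased power. Define k* = min{ k ∈ {0,1,…,T−1} : (U(T) − U(k))/(T − k) ≥ c } if this set is nonempty, and k* = T otherwise. Then the social welfare problem — maximize ∑_{i=1}^N U(h_i) − c ∑_{t=1}^T y_t over demand profiles h ∈ {0,…,T}^N and purchase vectors y ∈ ℕ^T subject to d ⪯^w (r + y), where d_t = #{i : h_i ≥ t} — attains its maximum at a solution whose demand-duration vector is d* given by: if k* ≥ 1, d*_t = r_t for t < k* and d*_t = r_{k*} for t ≥ k*; and if k* = 0, d*_t = N for all t; in each case with y a minimizer of ∑_t y_t over {y ∈ ℕ^T : d* ⪯^w (r + y)}. -/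
open Finset

/-- The demand-duration vector of the demand profile `h`:
`d t` is the number of consumers demanding at least `t+1` slots (`t` is 0-indexed). -/
def durations {T N : ℕ} (h : Fin N → ℕ) : Fin T → ℕ :=
  fun t => (univ.filter fun i => (t : ℕ) < h i).card

/-- Weak majorization `d ⪯^w p` for a nonincreasing `d`: every tail sum of `d`
is at most the corresponding tail sum of the nonincreasing rearrangement `p↓`
(this is adequacy of the supply `p` for the demand-duration vector `d`). -/
def MajW {T : ℕ} (d p : Fin T → ℕ) : Prop :=
  ∀ t : Fin T, ∑ s ∈ Ici t, d s ≤ ∑ s ∈ Ici t, sortedDesc p s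

/-- Extend a vector indexed by `Fin T` to all of `ℕ` (by `0` out of range). -/
def extendNat {T : ℕ} (r : Fin T → ℕ) : ℕ → ℕ := fun k => if h : k < T then r ⟨k, h⟩ else 0

lemma tail_sum_weighted_le {T : ℕ} {v : ℕ → ℝ} (hv0 : 0 < T → 0 ≤ v 0)
    (hv : ∀ t, t + 2 ≤ T → v t ≤ v (t + 1)) {a b : Fin T → ℝ}
    (hab : ∀ t, ∑ s ∈ Ici t, a s ≤ ∑ s ∈ Ici t, b s) :
    ∑ t : Fin T, v t * a t ≤ ∑ t : Fin T, v t * b t := by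
  let δ : ℕ → ℝ := fun s => if s = 0 then v 0 else v s - v (s - 1)
  have hδ : ∀ s : Fin T, 0 ≤ δ s := by
    rintro ⟨s, hs⟩
    cases s with
    | zero => simpa [δ] using hv0 hs
    | succ s => simpa [δ] using hv s (by omega)
  have hsum : ∀ t : ℕ, ∑ s ∈ range (t + 1), δ s = v t := by
    intro t
    have h := sum_range_sub v t
    rw [sum_range_succ']
    simp only [δ, Nat.add_one_ne_zero, if_false, if_true, Nat.add_sub_cancel, h]
    ring
  have hfin : ∀ t : Fin T, v t = ∑ s : Fin T, if s ≤ t then δ s else 0 := by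
    intro t
    simp only [Fin.le_def]
    rw [← hsum t, Fin.sum_univ_eq_sum_range (fun s => if s ≤ (t : ℕ) then δ s else 0) T,
      ← sum_filter]
    congr 1
    ext s
    simp only [mem_range, mem_filter]
    have := t.isLt
    omega
  have key : ∀ f : Fin T → ℝ, ∑ t : Fin T, v t * f t = ∑ s : Fin T, δ s * ∑ t ∈ Ici s, f t := by
    intro f
    simp_rw [hfin, sum_mul]
    rw [sum_comm]
    refine sum_congr rfl fun s _ => ?_
    rw [mul_sum, ← sum_filter_add_sum_filter_not univ (fun t => s ≤ t)]
    rw [sum_eq_zero (s := univ.filter fun t => ¬ s ≤ t), add_zero]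
    · refine sum_congr (by ext; simp) fun t ht => ?_
      rw [if_pos (by simpa using ht)]
    · intro t ht
      rw [if_neg (by simpa using ht), zero_mul]
  rw [key, key]
  exact sum_le_sum fun s _ => mul_le_mul_of_nonneg_left (hab s) (hδ s)

lemma sortedDesc_eq_comp_perm {T : ℕ} (a : Fin T → ℕ) :
    sortedDesc a = a ∘ (Fin.revPerm.trans (Tuple.sort a)) := rfl

lemma antitone_sortedDesc {T : ℕ} (a : Fin T → ℕ) : Antitone (sortedDesc a) :=
  fun _ _ h => Tuple.monotone_sort a (Fin.rev_le_rev.2 h)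

lemma sum_sortedDesc {T : ℕ} (a : Fin T → ℕ) : ∑ t, sortedDesc a t = ∑ t, a t :=
  Equiv.sum_comp (Fin.revPerm.trans (Tuple.sort a)) a

lemma sortedDesc_eq_self {T : ℕ} {a : Fin T → ℕ} (ha : Antitone a) : sortedDesc a = a := by
  have h : a ∘ (Fin.revPerm : Equiv.Perm (Fin T)) = a ∘ Tuple.sort a :=
    Tuple.comp_sort_eq_comp_iff_monotone.2 fun _ _ h => ha (Fin.rev_le_rev.2 h)
  funext t
  have := congrFun h t.rev
  simpa [sortedDesc] using this.symm

lemma MajW.sum_le {T : ℕ} {d p : Fin T → ℕ} (h : MajW d p) : ∑ t, d t ≤ ∑ t, p t := by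
  cases T with
  | zero => simp
  | succ n =>
    have hIci : Ici (0 : Fin (n + 1)) = univ := by ext; simp
    have := h 0
    rwa [hIci, sum_sortedDesc] at this

lemma MajW.weighted_le {T : ℕ} {d p : Fin T → ℕ} (h : MajW d p) {v : ℕ → ℝ}
    (hv0 : 0 < T → 0 ≤ v 0) (hv : ∀ t, t + 2 ≤ T → v t ≤ v (t + 1)) :
    ∑ t : Fin T, v t * (d t : ℝ) ≤ ∑ t : Fin T, v t * (p t : ℝ) := by
  have hmono : Monotone fun t : Fin T => v t := by
    have aux : ∀ n s : ℕ, s + n < T → v s ≤ v (s + n) := by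
      intro n
      induction n with
      | zero => intro s _; exact le_rfl
      | succ n ih => intro s hs; exact (ih s (by omega)).trans (hv _ (by omega))
    intro s t hst
    have hst' : (s : ℕ) ≤ t := hst
    have := aux (t - s) s (by omega)
    rwa [Nat.add_sub_cancel' hst'] at this
  have h1 : ∑ t : Fin T, v t * (d t : ℝ) ≤ ∑ t : Fin T, v t * (sortedDesc p t : ℝ) :=
    tail_sum_weighted_le hv0 hv fun t => by exact_mod_cast h t
  refine h1.trans ?_
  let σ : Equiv.Perm (Fin T) := Fin.revPerm.trans (Tuple.sort p)
  have hanti : Antivary (fun t : Fin T => v t) fun t => (sortedDesc p t : ℝ) :=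
    hmono.antivary fun _ _ hst => Nat.cast_le.2 (antitone_sortedDesc p hst)
  have := hanti.sum_mul_le_sum_mul_comp_perm (σ := σ.symm)
  refine this.trans_eq (sum_congr rfl fun t _ => ?_)
  have : sortedDesc p (σ.symm t) = p t := by
    rw [sortedDesc_eq_comp_perm]
    exact congrArg p (σ.apply_symm_apply t)
  rw [this]

lemma sum_eq_sum_durations {T N : ℕ} (V : ℕ → ℝ) (h : Fin N → ℕ) (hh : ∀ i, h i ≤ T) :
    ∑ i, V (h i) =
      N * V 0 + ∑ t : Fin T, (V (t + 1) - V t) * (durations (T := T) h t : ℝ) := by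
  have h1 : ∀ i, V (h i) =
      V 0 + ∑ t : Fin T, (if (t : ℕ) < h i then V (t + 1) - V t else 0) := by
    intro i
    rw [Fin.sum_univ_eq_sum_range (fun t => if t < h i then V (t + 1) - V t else 0) T,
      ← sum_filter]
    have : (range T).filter (fun t => t < h i) = range (h i) := by
      ext t
      have := hh i
      simp only [mem_range, mem_filter]
      omega
    rw [this, sum_range_sub]
    ring
  rw [sum_congr rfl fun i _ => h1 i, sum_add_distrib, sum_comm]
  congr 1
  · simp
  · refine sum_congr rfl fun t _ => ?_
    rw [← sum_filter, sum_const, nsmul_eq_mul, mul_comm]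
    rfl

/-- The demand profile conjugate to `d`. -/
def conjProfile {T : ℕ} (N : ℕ) (d : Fin T → ℕ) : Fin N → ℕ :=
  fun i => (univ.filter fun t => (i : ℕ) < d t).card

lemma conjProfile_le {T N : ℕ} (d : Fin T → ℕ) (i : Fin N) : conjProfile N d i ≤ T := by
  simpa [conjProfile] using card_le_univ (univ.filter fun t => (i : ℕ) < d t)

lemma lt_conjProfile_iff {T N : ℕ} {d : Fin T → ℕ} (hd : Antitone d) (i : Fin N) (t : Fin T) :
    (t : ℕ) < conjProfile N d i ↔ (i : ℕ) < d t := by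
  constructor
  · intro h
    by_contra hlt
    have hsub : (univ.filter fun s => (i : ℕ) < d s) ⊆ Iio t := by
      intro s hs
      rw [mem_filter] at hs
      rw [mem_Iio]
      by_contra hts
      have := hd (not_lt.1 hts)
      omega
    have := card_le_card hsub
    rw [Fin.card_Iio] at this
    exact absurd h (not_lt.2 this)
  · intro h
    have hsub : Iic t ⊆ univ.filter fun s => (i : ℕ) < d s := by
      intro s hs
      rw [mem_Iic] at hs
      simpa using h.trans_le (hd hs)
    have := card_le_card hsub
    rw [Fin.card_Iic] at this
    exact this

lemma durations_conjProfile {T N : ℕ} {d : Fin T → ℕ} (hd : Antitone d) (hN : ∀ t, d t ≤ N)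
    (t : Fin T) : durations (T := T) (conjProfile N d) t = d t := by
  simp only [durations, lt_conjProfile_iff hd]
  rw [Fin.card_filter_val_lt, min_eq_right (hN t)]

lemma convex_increments_bound {T : ℕ} {U : ℕ → ℝ}
    (hU : ∀ k : ℕ, k + 2 ≤ T → U (k + 1) - U k ≤ U (k + 2) - U (k + 1)) (h n : ℕ)
    (hn : h + 1 + n ≤ T) :
    n * (U (h + 1) - U h) ≤ U (h + 1 + n) - U (h + 1) ∧
      U (h + 1) - U h ≤ U (h + 1 + n) - U (h + n) := by
  induction n with
  | zero => simp
  | succ n ih =>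
    obtain ⟨h1, h2⟩ := ih (by omega)
    have h3 := hU (h + n) (by omega)
    rw [show h + n + 2 = h + 1 + (n + 1) by ring, show h + n + 1 = h + 1 + n by ring] at h3
    rw [show h + (n + 1) = h + 1 + n by ring]
    push_cast
    constructor <;> linarith

/-- If the average increment of a convex `U` on `[k, T]` is at least `c`, so is the one
on `[h, T]` for every later `h`. -/
lemma convex_tail_average {T : ℕ} {U : ℕ → ℝ}
    (hU : ∀ k : ℕ, k + 2 ≤ T → U (k + 1) - U k ≤ U (k + 2) - U (k + 1)) {c : ℝ} {k : ℕ}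
    (hk : c * ((T : ℝ) - k) ≤ U T - U k) {h : ℕ} (hkh : k ≤ h) (hT : h ≤ T) :
    c * ((T : ℝ) - h) ≤ U T - U h := by
  induction h, hkh using Nat.le_induction with
  | base => exact hk
  | succ h _ ih =>
    have h1 := ih (by omega)
    obtain ⟨h2, -⟩ := convex_increments_bound hU h (T - (h + 1)) (by omega)
    rw [Nat.add_sub_cancel' hT, Nat.cast_sub hT] at h2
    have hT' : ((h + 1 : ℕ) : ℝ) ≤ T := by exact_mod_cast hT
    push_cast at h2 hT' ⊢
    rcases le_total c (U (h + 1) - U h) with hc | hc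
    · nlinarith
    · linarith

/-- Social welfare maximization with convex utility: with `r` nonincreasing, `U`
having nonnegative nondecreasing increments on `{0,…,T}`, `N > r_1`, price `c ≥ 0`,
and `k* = min{k ∈ {0,…,T-1} : (U(T)−U(k))/(T−k) ≥ c}` (`k* = T` if none), the
social welfare problem attains its maximum at a solution whose demand-duration
vector is `d*`, where `d*_t = r_t` for `t < k*` and `d*_t = r_{k*}` for `t ≥ k*`
(1-indexed; i.e. `d*_t = r_{min(t, k*-1)}` 0-indexed) if `k* ≥ 1`, and `d*_t = N`
for all `t` if `k* = 0`, together with a `y` minimizing `∑ y_t` subject to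
`d* ⪯^w (r + y)`. -/
theorem social_welfare_convex {T N : ℕ} (hT : 0 < T)
    (r : Fin T → ℕ) (hr : Antitone r)
    (U : ℕ → ℝ) (hU0 : U 0 = 0)
    (hUpos : ∀ k : ℕ, k < T → U k ≤ U (k + 1))
    (hUconv : ∀ k : ℕ, k + 2 ≤ T → U (k + 1) - U k ≤ U (k + 2) - U (k + 1))
    (c : ℝ) (hc : 0 ≤ c)
    (hN : r ⟨0, hT⟩ < N)
    (kstar : ℕ)
    (hk1 : (∃ k, k < T ∧ c ≤ (U T - U k) / ((T : ℝ) - (k : ℝ))) →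
      kstar < T ∧ c ≤ (U T - U kstar) / ((T : ℝ) - (kstar : ℝ)) ∧
        ∀ j, j < kstar → ¬ c ≤ (U T - U j) / ((T : ℝ) - (j : ℝ)))
    (hk2 : (¬ ∃ k, k < T ∧ c ≤ (U T - U k) / ((T : ℝ) - (k : ℝ))) → kstar = T)
    (dstar : Fin T → ℕ)
    (hd1 : 1 ≤ kstar → ∀ t : Fin T, dstar t = extendNat r (min (t : ℕ) (kstar - 1)))
    (hd2 : kstar = 0 → ∀ t : Fin T, dstar t = N) :
    ∃ (hstar : Fin N → ℕ) (ystar : Fin T → ℕ),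
      (∀ i, hstar i ≤ T) ∧
      -- the optimal demand profile has demand-duration vector `d*`
      (∀ t : Fin T, durations (T := T) hstar t = dstar t) ∧
      -- `ystar` is feasible and minimizes total purchase for `d*`
      MajW dstar (fun t => r t + ystar t) ∧
      (∀ y : Fin T → ℕ, MajW dstar (fun t => r t + y t) →
        ∑ t, ystar t ≤ ∑ t, y t) ∧
      -- `(hstar, ystar)` maximizes social welfare among all feasible `(h, y)`
      (∀ (h : Fin N → ℕ) (y : Fin T → ℕ), (∀ i, h i ≤ T) →
        MajW (durations (T := T) h) (fun t => r t + y t) →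
        ∑ i, U (h i) - c * ∑ t, (y t : ℝ) ≤
          ∑ i, U (hstar i) - c * ∑ t, (ystar t : ℝ)) := by
  obtain ⟨hkT, hA, hB⟩ : kstar ≤ T ∧ c * ((T : ℝ) - kstar) ≤ U T - U kstar ∧
      ∀ j, j < kstar → U T - U j < c * ((T : ℝ) - j) := by
    have hpos : ∀ j, j < T → (0 : ℝ) < (T : ℝ) - j := fun j hj =>
      sub_pos.2 (Nat.cast_lt.2 hj)
    by_cases hex : ∃ k, k < T ∧ c ≤ (U T - U k) / ((T : ℝ) - (k : ℝ))
    · obtain ⟨h1, h2, h3⟩ := hk1 hex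
      refine ⟨h1.le, (le_div_iff₀ (hpos _ h1)).1 h2, fun j hj => ?_⟩
      exact (div_lt_iff₀ (hpos _ (hj.trans h1))).1 (not_le.1 (h3 j hj))
    · have h1 := hk2 hex
      subst h1
      refine ⟨le_rfl, by simp, fun j hj => ?_⟩
      exact (div_lt_iff₀ (hpos _ hj)).1 (not_le.1 fun hle => hex ⟨j, hj, hle⟩)
  have hr0 : ∀ t, r t ≤ N := fun t => (hr (show (⟨0, hT⟩ : Fin T) ≤ t from Nat.zero_le _)).trans hN.le
  have hd1' : ∀ (hk : 1 ≤ kstar) (t : Fin T),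
      dstar t = r ⟨min t (kstar - 1), by omega⟩ := by
    intro hk t
    rw [hd1 hk t, extendNat, dif_pos]
  have hdanti : Antitone dstar := by
    intro s t hst
    rcases Nat.eq_zero_or_pos kstar with hk | hk
    · rw [hd2 hk, hd2 hk]
    · rw [hd1' hk, hd1' hk]
      exact hr (Fin.mk_le_mk.2 (min_le_min_right _ hst))
  have hdN : ∀ t, dstar t ≤ N := by
    intro t
    rcases Nat.eq_zero_or_pos kstar with hk | hk
    · rw [hd2 hk]
    · rw [hd1' hk]
      exact hr0 _
  have hrd : ∀ t, r t ≤ dstar t := by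
    intro t
    rcases Nat.eq_zero_or_pos kstar with hk | hk
    · rw [hd2 hk]
      exact hr0 t
    · rw [hd1' hk]
      exact hr (Fin.mk_le_mk.2 (min_le_left _ _))
  have hdr : ∀ t : Fin T, (t : ℕ) < kstar → dstar t = r t := by
    intro t ht
    rw [hd1' (by omega)]
    congr 1
    exact Fin.ext (min_eq_left (by omega))
  have hry : (fun t => r t + (dstar t - r t)) = dstar :=
    funext fun t => Nat.add_sub_cancel' (hrd t)
  have hstar_cases : ∀ i : Fin N,
      conjProfile N dstar i < kstar ∨ conjProfile N dstar i = T := by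
    intro i
    by_contra! hcon
    obtain ⟨h1, h2⟩ := hcon
    have h3 := (conjProfile_le dstar i).lt_of_ne h2
    have h4 : (i : ℕ) < dstar ⟨T - 1, by omega⟩ := by
      rcases Nat.eq_zero_or_pos kstar with hk | hk
      · rw [hd2 hk]
        exact i.isLt
      · have h5 := (lt_conjProfile_iff hdanti i ⟨kstar - 1, by omega⟩).1
          (show kstar - 1 < _ by omega)
        rw [hd1' hk] at h5 ⊢
        simpa [min_eq_right (show kstar - 1 ≤ T - 1 by omega)] using h5
    have h6 := (lt_conjProfile_iff hdanti i ⟨T - 1, by omega⟩).2 h4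
    have h7 : T - 1 < conjProfile N dstar i := h6
    omega
  let V : ℕ → ℝ := fun h => if h < kstar then U h else U T - c * ((T : ℝ) - h)
  have hVlt : ∀ h, h < kstar → V h = U h := fun h hh => if_pos hh
  have hVge : ∀ h, kstar ≤ h → V h = U T - c * ((T : ℝ) - h) := fun h hh =>
    if_neg (not_lt.2 hh)
  have hVT : V T = U T := by rw [hVge T hkT]; ring
  have hUV : ∀ h, h ≤ T → U h ≤ V h := by
    intro h hh
    rcases lt_or_ge h kstar with hk | hk
    · rw [hVlt h hk]
    · rw [hVge h hk]
      linarith [convex_tail_average hUconv hA hk hh]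
  have hvc : ∀ t, kstar ≤ t → V (t + 1) - V t = c := by
    intro t ht
    rw [hVge t ht, hVge (t + 1) (by omega)]
    push_cast
    ring
  have hvmono : ∀ t, t + 2 ≤ T → V (t + 1) - V t ≤ V (t + 1 + 1) - V (t + 1) := by
    intro t ht
    rcases lt_or_ge (t + 1) kstar with hk | hk
    · have := hUV (t + 2) ht
      rw [hVlt t (by omega), hVlt (t + 1) hk]
      linarith [hUconv t ht]
    · rw [hvc (t + 1) hk]
      rcases Nat.lt_or_ge t kstar with hk' | hk'
      · rw [hVlt t hk', hVge (t + 1) hk]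
        have := hB t hk'
        push_cast
        linarith
      · exact (hvc t hk').le
  have hv0 : 0 ≤ V (0 + 1) - V 0 := by
    rcases Nat.eq_zero_or_pos kstar with hk | hk
    · rw [hvc 0 hk.le]
      exact hc
    · rw [hVlt 0 hk]
      linarith [hUpos 0 hT, hUV (0 + 1) (by omega)]
  have hvle : ∀ n t, t + n + 1 = T → V (t + 1) - V t ≤ c := by
    intro n
    induction n with
    | zero =>
      intro t ht
      rcases Nat.lt_or_ge t kstar with hk | hk
      · have hB' := hB t hk
        have hT1 : t + 1 = T := ht
        rw [hT1, hVT, hVlt t hk]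
        have : (T : ℝ) = t + 1 := by exact_mod_cast hT1.symm
        rw [this] at hB'
        linarith
      · exact (hvc t hk).le
    | succ n ih =>
      intro t ht
      exact (hvmono t (by omega)).trans (ih (t + 1) (by omega))
  refine ⟨conjProfile N dstar, fun t => dstar t - r t, conjProfile_le dstar,
    durations_conjProfile hdanti hdN, ?_, ?_, ?_⟩
  · intro t
    rw [hry, sortedDesc_eq_self hdanti]
  · intro y hy
    have h1 := hy.sum_le
    rw [sum_add_distrib] at h1
    show ∑ t, (dstar t - r t) ≤ _
    have h2 := congrArg (fun f => ∑ t, f t) hry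
    simp only [sum_add_distrib] at h2
    omega
  · intro h y hh hy
    have h1 : ∑ i, U (h i) ≤ ∑ i, V (h i) := sum_le_sum fun i _ => hUV _ (hh i)
    rw [sum_eq_sum_durations V h hh] at h1
    have h2 := hy.weighted_le (v := fun t => V (t + 1) - V t) (fun _ => hv0) hvmono
    have h3 : ∑ t : Fin T, (V (t + 1) - V t) * ((r t + y t : ℕ) : ℝ) ≤
        ∑ t : Fin T, (V (t + 1) - V t) * (r t : ℝ) + c * ∑ t, (y t : ℝ) := by
      rw [mul_sum, ← sum_add_distrib]
      refine sum_le_sum fun t _ => ?_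
      have := mul_le_mul_of_nonneg_right (hvle (T - 1 - t) t (by omega))
        (Nat.cast_nonneg (α := ℝ) (y t))
      push_cast
      linarith
    have h4 : ∑ i, U (conjProfile N dstar i) = ∑ i, V (conjProfile N dstar i) := by
      refine sum_congr rfl fun i _ => ?_
      rcases hstar_cases i with hi | hi
      · rw [hVlt _ hi]
      · rw [hi, hVT]
    rw [sum_eq_sum_durations V _ (conjProfile_le dstar)] at h4
    simp only [durations_conjProfile hdanti hdN] at h4
    have h5 : ∑ t : Fin T, (V (t + 1) - V t) * (dstar t : ℝ) =
        ∑ t : Fin T, (V (t + 1) - V t) * (r t : ℝ) + c * ∑ t, ((dstar t - r t : ℕ) : ℝ) := by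
      rw [mul_sum, ← sum_add_distrib]
      refine sum_congr rfl fun t _ => ?_
      rcases Nat.lt_or_ge t kstar with hk | hk
      · simp [hdr t hk]
      · rw [hvc t hk, Nat.cast_sub (hrd t)]
        ring
    linarith
end
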